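/- Suppose SOL^w(K_∞, f^∞) = {0}. Then for every vector polynomial g = (g_1, …, g_s) : ℝ^n → ℝ^s with deg g_i < deg f_i for all i ∈ {1, …, s}, the set SOL^s(K, f + g) is nonempty and the set SOL^w(K, f + g) is compact. -/

import Mathlib

open Filter Topology MvPolynomial

/-- The asymptotic cone of a set `K ⊆ ℝⁿ`:
`K_∞ = {v : ∃ t_k → +∞, x_k ∈ K with x_k / t_k → v}`. -/
def asympCone {n : ℕ} (K : Set (Fin n → ℝ)) : Set (Fin n → ℝ) :=
  {v | ∃ (t : ℕ → ℝ) (x : ℕ → (Fin n → ℝ)), (∀ k, x k ∈ K) ∧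
    Tendsto t atTop atTop ∧ Tendsto (fun k => (t k)⁻¹ • x k) atTop (nhds v)}

/-- The weak Pareto efficient solution set of the vector function `p` on `C`:
`x* ∈ C` such that for no `x ∈ C` we have `p(x) - p(x*) ∈ -int ℝˢ₊`. -/
def SOLw {n s : ℕ} (C : Set (Fin n → ℝ)) (p : Fin s → (Fin n → ℝ) → ℝ) : Set (Fin n → ℝ) :=
  {x | x ∈ C ∧ ∀ y ∈ C, ¬ (∀ i, p i y < p i x)}

/-- The Pareto efficient solution set of the vector function `p` on `C`:
`x* ∈ C` such that for no `x ∈ C` we have `p(x) - p(x*) ∈ -ℝˢ₊ \ {0}`. -/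
def SOLs {n s : ℕ} (C : Set (Fin n → ℝ)) (p : Fin s → (Fin n → ℝ) → ℝ) : Set (Fin n → ℝ) :=
  {x | x ∈ C ∧ ∀ y ∈ C, ¬ ((∀ i, p i y ≤ p i x) ∧ (∃ i, p i y < p i x))}

/-- The set of global minimizers of the scalar function `q` on `C`. -/
def SOLmin {n : ℕ} (C : Set (Fin n → ℝ)) (q : (Fin n → ℝ) → ℝ) : Set (Fin n → ℝ) :=
  {x | x ∈ C ∧ ∀ y ∈ C, q x ≤ q y}

/-- The recession polynomial (vector leading term) of `p`, as a function:
`p^∞(x) = lim_{λ→+∞} p(λx)/λ^{deg p}`, i.e. the evaluation of the homogeneous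
component of `p` of top degree. -/
noncomputable def recFn {n : ℕ} (p : MvPolynomial (Fin n) ℝ) : (Fin n → ℝ) → ℝ :=
  fun x => eval x (homogeneousComponent p.totalDegree p)

/-- Evaluation of a polynomial, as a function `ℝⁿ → ℝ`. -/
noncomputable def evalFn {n : ℕ} (p : MvPolynomial (Fin n) ℝ) : (Fin n → ℝ) → ℝ :=
  fun x => eval x p

/-- `⟨∇p^∞(x), y⟩`: the inner product of the gradient of the recession polynomial
of `p` at `x` with `y`. -/
noncomputable def gradRecInner {n : ℕ} (p : MvPolynomial (Fin n) ℝ) (x y : Fin n → ℝ) : ℝ :=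
  ∑ j, (eval x (pderiv j (homogeneousComponent p.totalDegree p))) * y j

/-- `x` is a solution of the weak vector complementarity problem
`WVCP(C, ∇f^∞)`. -/
def isWVCPsol {n s : ℕ} (C : Set (Fin n → ℝ)) (f : Fin s → MvPolynomial (Fin n) ℝ)
    (x : Fin n → ℝ) : Prop :=
  x ∈ C ∧ (∀ y ∈ C, ¬ (∀ i, gradRecInner (f i) x y < 0)) ∧
    ¬ (∀ i, 0 < gradRecInner (f i) x x)

theorem aux_eval_smul {n : ℕ} {q : MvPolynomial (Fin n) ℝ} {d : ℕ} (hq : q.IsHomogeneous d)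
    (r : ℝ) (x : Fin n → ℝ) : eval (r • x) q = r ^ d * eval x q := by
  rw [eval_eq, eval_eq, Finset.mul_sum]
  refine Finset.sum_congr rfl fun m hm => ?_
  have h1 : m.degree = d := by
    rw [Finsupp.degree_eq_weight_one]
    exact hq (mem_support_iff.1 hm)
  have h2 : ∏ i ∈ m.support, r ^ m i = r ^ d := by
    rw [Finset.prod_pow_eq_pow_sum, ← h1]
    rfl
  simp only [Pi.smul_apply, smul_eq_mul, mul_pow, Finset.prod_mul_distrib, h2]
  ring

theorem aux_tendsto {n : ℕ} (q : MvPolynomial (Fin n) ℝ) (d : ℕ) (hq : q.totalDegree ≤ d)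
    (t : ℕ → ℝ) (x : ℕ → Fin n → ℝ) (v : Fin n → ℝ) (ht : Tendsto t atTop atTop)
    (hx : Tendsto (fun k => (t k)⁻¹ • x k) atTop (nhds v)) :
    Tendsto (fun k => ((t k)⁻¹) ^ d * eval (x k) q) atTop
      (nhds (eval v (homogeneousComponent d q))) := by
  have hinv : Tendsto (fun k => (t k)⁻¹) atTop (nhds 0) := tendsto_inv_atTop_zero.comp ht
  have key : ∀ j ∈ Finset.range (d + 1),
      Tendsto (fun k => ((t k)⁻¹) ^ (d - j) *
        eval ((t k)⁻¹ • x k) (homogeneousComponent j q)) atTop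
        (nhds (0 ^ (d - j) * eval v (homogeneousComponent j q))) := by
    intro j _
    exact (hinv.pow _).mul (((MvPolynomial.continuous_eval _).tendsto v).comp hx)
  have hsum := tendsto_finsetSum _ key
  have hlim : ∑ j ∈ Finset.range (d + 1), (0:ℝ) ^ (d - j) * eval v (homogeneousComponent j q)
      = eval v (homogeneousComponent d q) := by
    rw [Finset.sum_range_succ, Finset.sum_eq_zero]
    · simp
    · intro j hj
      have : d - j ≠ 0 := by have := Finset.mem_range.1 hj; omega
      simp [this]
  rw [hlim] at hsum
  refine hsum.congr' ?_
  filter_upwards [ht.eventually_gt_atTop 0] with k hk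
  have hq' : q = ∑ j ∈ Finset.range (d + 1), homogeneousComponent j q := by
    conv_lhs => rw [← MvPolynomial.sum_homogeneousComponent q]
    refine Finset.sum_subset ?_ ?_
    · intro j hj; simp only [Finset.mem_range] at *; omega
    · intro j _ hj
      apply homogeneousComponent_eq_zero
      simp only [Finset.mem_range] at hj; omega
  conv_rhs => rw [hq', map_sum, Finset.mul_sum]
  refine Finset.sum_congr rfl fun j hj => ?_
  have hj' : j ≤ d := by have := Finset.mem_range.1 hj; omega
  rw [aux_eval_smul (homogeneousComponent_isHomogeneous j q)]
  rw [← mul_assoc, ← pow_add, Nat.sub_add_cancel hj']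

theorem aux_bounded {n : ℕ} {ι : Type*} (C : Set (Fin n → ℝ)) (Q : ι → MvPolynomial (Fin n) ℝ)
    (d : ι → ℕ) (hd : ∀ i, 1 ≤ d i) (hQ : ∀ i, (Q i).totalDegree ≤ d i) (c : ι → ℝ)
    (hC : ∀ v ∈ asympCone C, v ≠ 0 → ∃ i, 0 < eval v (homogeneousComponent (d i) (Q i))) :
    Bornology.IsBounded {x | x ∈ C ∧ ∀ i, eval x (Q i) ≤ c i} := by
  by_contra hb
  have h1 : ∀ k : ℕ, ∃ x, (x ∈ C ∧ ∀ i, eval x (Q i) ≤ c i) ∧ (k : ℝ) < ‖x‖ := by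
    intro k
    by_contra hk
    push Not at hk
    exact hb (isBounded_iff_forall_norm_le.2 ⟨k, fun x hx => hk x hx⟩)
  choose x hx hxk using h1
  have ht : Tendsto (fun k => ‖x k‖) atTop atTop :=
    tendsto_atTop_mono (fun k => (hxk k).le) tendsto_natCast_atTop_atTop
  have hsph : ∀ k, ‖x k‖⁻¹ • x k ∈ Metric.sphere (0 : Fin n → ℝ) 1 := by
    intro k
    have : 0 < ‖x k‖ := lt_of_le_of_lt (Nat.cast_nonneg k) (hxk k)
    rw [mem_sphere_zero_iff_norm, norm_smul, norm_inv, norm_norm, inv_mul_cancel₀ this.ne']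
  obtain ⟨v, hv, φ, hφ, hlim⟩ := (isCompact_sphere (0 : Fin n → ℝ) 1).tendsto_subseq hsph
  have ht' := ht.comp hφ.tendsto_atTop
  have hv0 : v ≠ 0 := by
    rintro rfl
    simp at hv
  obtain ⟨i, hi⟩ := hC v ⟨fun k => ‖x (φ k)‖, fun k => x (φ k), fun k => (hx _).1, ht', hlim⟩ hv0
  have l1 := aux_tendsto (Q i) (d i) (hQ i) (fun k => ‖x (φ k)‖) (fun k => x (φ k)) v ht' hlim
  have l2 : Tendsto (fun k => (‖x (φ k)‖⁻¹) ^ (d i) * c i) atTop (nhds (0 ^ (d i) * c i)) :=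
    ((tendsto_inv_atTop_zero.comp ht').pow _).mul_const _
  have h0 : (0:ℝ) ^ (d i) * c i = 0 := by
    have : d i ≠ 0 := by have := hd i; omega
    simp [this]
  rw [h0] at l2
  have := le_of_tendsto_of_tendsto' l1 l2
    (fun k => mul_le_mul_of_nonneg_left ((hx _).2 i) (by positivity))
  linarith

theorem aux_exists {n s : ℕ} (C : Set (Fin n → ℝ)) (hC : IsClosed C)
    (p : Fin s → (Fin n → ℝ) → ℝ) (hp : ∀ i, Continuous (p i)) (z : Fin n → ℝ) (hz : z ∈ C)
    (hb : Bornology.IsBounded {x | x ∈ C ∧ ∀ i, p i x ≤ p i z}) :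
    ∃ w ∈ SOLs C p, ∀ i, p i w ≤ p i z := by
  have hcl : IsClosed {x | x ∈ C ∧ ∀ i, p i x ≤ p i z} := by
    have heq : {x | x ∈ C ∧ ∀ i, p i x ≤ p i z} = C ∩ ⋂ i, {x | p i x ≤ p i z} := by
      ext x
      simp
    rw [heq]
    exact hC.inter (isClosed_iInter fun i => isClosed_le (hp i) continuous_const)
  have hcomp := Metric.isCompact_of_isClosed_isBounded hcl hb
  obtain ⟨w, hw, hmin⟩ := hcomp.exists_isMinOn ⟨z, hz, fun i => le_rfl⟩
    (f := fun x => ∑ i, p i x) (continuous_finsetSum _ fun i _ => hp i).continuousOn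
  refine ⟨w, ⟨hw.1, ?_⟩, hw.2⟩
  rintro y hy ⟨h1, i, hi⟩
  have h2 : ∑ i, p i w ≤ ∑ i, p i y := hmin ⟨hy, fun i => (h1 i).trans (hw.2 i)⟩
  have h3 : ∑ i, p i y < ∑ i, p i w :=
    Finset.sum_lt_sum (fun i _ => h1 i) ⟨i, Finset.mem_univ _, hi⟩
  linarith

theorem aux_cone_iff {n : ℕ} (K : Set (Fin n → ℝ)) (v : Fin n → ℝ) :
    v ∈ asympCone K ↔ ∀ ε > 0, ∀ T : ℝ, ∃ t > T, ∃ x ∈ K, dist (t⁻¹ • x) v < ε := by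
  constructor
  · rintro ⟨t, x, hx, ht, hl⟩ ε hε T
    obtain ⟨k, hk1, hk2⟩ := ((ht.eventually_gt_atTop T).and
      (Metric.tendsto_nhds.1 hl ε hε)).exists
    exact ⟨t k, hk1, x k, hx k, hk2⟩
  · intro H
    have := fun k : ℕ => H (1 / ((k:ℝ) + 1)) (by positivity) k
    choose t ht x hx hd using this
    refine ⟨t, x, hx, tendsto_atTop_mono (fun k => (ht k).le) tendsto_natCast_atTop_atTop, ?_⟩
    rw [tendsto_iff_dist_tendsto_zero]
    exact squeeze_zero (fun _ => dist_nonneg) (fun k => (hd k).le)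
      tendsto_one_div_add_atTop_nhds_zero_nat

theorem aux_cone_closed {n : ℕ} (K : Set (Fin n → ℝ)) : IsClosed (asympCone K) := by
  rw [← closure_subset_iff_isClosed]
  intro v hv
  rw [aux_cone_iff]
  intro ε hε T
  obtain ⟨u, hu, huv⟩ := Metric.mem_closure_iff.1 hv (ε / 2) (by positivity)
  obtain ⟨t, ht, x, hx, hd⟩ := (aux_cone_iff K u).1 hu (ε / 2) (by positivity) T
  refine ⟨t, ht, x, hx, ?_⟩
  have := dist_triangle (t⁻¹ • x) u v
  rw [dist_comm] at huv
  linarith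

theorem aux_cone_smul {n : ℕ} (K : Set (Fin n → ℝ)) (v : Fin n → ℝ) (hv : v ∈ asympCone K)
    (c : ℝ) (hc : 0 < c) : c • v ∈ asympCone K := by
  obtain ⟨t, x, hx, ht, hl⟩ := hv
  refine ⟨fun k => c⁻¹ * t k, x, hx, ht.const_mul_atTop (by positivity), ?_⟩
  refine (hl.const_smul c).congr fun k => ?_
  rw [smul_smul, mul_inv, inv_inv]

theorem aux_cone_cone {n : ℕ} (K : Set (Fin n → ℝ)) : asympCone (asympCone K) ⊆ asympCone K := by
  rintro v ⟨t, x, hx, ht, hl⟩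
  refine (aux_cone_closed K).mem_of_tendsto hl ?_
  filter_upwards [ht.eventually_gt_atTop 0] with k hk
  exact aux_cone_smul K _ (hx k) _ (by positivity)

theorem stmt18 {n s : ℕ} (hs : 0 < s) (K : Set (Fin n → ℝ)) (hK : K.Nonempty) (hKc : IsClosed K)
    (f : Fin s → MvPolynomial (Fin n) ℝ) (hdeg : ∀ i, 1 ≤ (f i).totalDegree)
    (h : SOLw (asympCone K) (fun i => recFn (f i)) = {0})
    (g : Fin s → MvPolynomial (Fin n) ℝ)
    (hg : ∀ i, (g i).totalDegree < (f i).totalDegree) :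
    (SOLs K (fun i => evalFn (f i + g i))).Nonempty ∧
      IsCompact (SOLw K (fun i => evalFn (f i + g i))) := by
  have hzero : ∀ i, recFn (f i) 0 = 0 := by
    intro i
    have h1 := aux_eval_smul (homogeneousComponent_isHomogeneous (f i).totalDegree (f i)) 0 0
    have : (f i).totalDegree ≠ 0 := by have := hdeg i; omega
    simpa [this, recFn] using h1
  have h0 : (0 : Fin n → ℝ) ∈ SOLw (asympCone K) (fun i => recFn (f i)) := by rw [h]; rfl
  have hdom : ∀ v ∈ asympCone K, v ≠ 0 →
      ∃ z ∈ asympCone K, ∀ i, recFn (f i) z < recFn (f i) v := by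
    intro v hv hv0
    by_contra hcon
    push Not at hcon
    have : v ∈ SOLw (asympCone K) (fun i => recFn (f i)) := by
      refine ⟨hv, fun y hy hlt => ?_⟩
      obtain ⟨i, hi⟩ := hcon y hy
      exact absurd (hlt i) (not_lt.2 hi)
    rw [h] at this
    exact hv0 this
  have hsome : ∀ v ∈ asympCone K, v ≠ 0 → ∃ i, 0 < recFn (f i) v := by
    intro v hv hv0
    by_contra hcon
    push Not at hcon
    obtain ⟨z, hz, hzv⟩ := hdom v hv hv0
    refine h0.2 z hz fun i => ?_
    show recFn (f i) z < recFn (f i) 0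
    rw [hzero]
    exact (hzv i).trans_le (hcon i)
  have hall : ∀ v ∈ asympCone K, v ≠ 0 → ∀ i, 0 < recFn (f i) v := by
    intro v hv hv0
    obtain ⟨z, hz, hzv⟩ := hdom v hv hv0
    have hb := aux_bounded (asympCone K)
      (fun i => homogeneousComponent (f i).totalDegree (f i)) (fun i => (f i).totalDegree) hdeg
      (fun i => (homogeneousComponent_isHomogeneous _ _).totalDegree_le)
      (fun i => recFn (f i) z) (by
        intro u hu hu0
        obtain ⟨i, hi⟩ := hsome u (aux_cone_cone K hu) hu0
        refine ⟨i, ?_⟩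
        rw [homogeneousComponent_of_mem (homogeneousComponent_isHomogeneous _ _), if_pos rfl]
        exact hi)
    obtain ⟨w, hw, hwz⟩ := aux_exists (asympCone K) (aux_cone_closed K) (fun i => recFn (f i))
      (fun i => MvPolynomial.continuous_eval _) z hz hb
    have hw' : w ∈ SOLw (asympCone K) (fun i => recFn (f i)) :=
      ⟨hw.1, fun y hy hlt => hw.2 y hy ⟨fun i => (hlt i).le, ⟨0, hs⟩, hlt _⟩⟩
    rw [h] at hw'
    have hw0 : w = 0 := hw'
    intro i
    have := hwz i
    simp only [hw0, hzero] at this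
    exact this.trans_lt (hzv i)
  have hcomp : ∀ i, homogeneousComponent (f i).totalDegree (f i + g i)
      = homogeneousComponent (f i).totalDegree (f i) := by
    intro i
    rw [map_add, homogeneousComponent_eq_zero _ (g i) (hg i), add_zero]
  have htd : ∀ i, (f i + g i).totalDegree ≤ (f i).totalDegree := fun i =>
    (totalDegree_add _ _).trans (max_le le_rfl (hg i).le)
  have hbd : ∀ i c, Bornology.IsBounded {x | x ∈ K ∧ evalFn (f i + g i) x ≤ c} := by
    intro i c
    refine (aux_bounded K (fun _ : Unit => f i + g i) (fun _ => (f i).totalDegree)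
      (fun _ => hdeg i) (fun _ => htd i) (fun _ => c) ?_).subset ?_
    · intro v hv hv0
      refine ⟨(), ?_⟩
      rw [hcomp]
      exact hall v hv hv0 i
    · exact fun x hx => ⟨hx.1, fun _ => hx.2⟩
  have hcont : ∀ i, Continuous (evalFn (f i + g i)) := fun i => MvPolynomial.continuous_eval _
  obtain ⟨a, ha⟩ := hK
  constructor
  · obtain ⟨w, hw, _⟩ := aux_exists K hKc (fun i => evalFn (f i + g i)) hcont a ha
      ((hbd ⟨0, hs⟩ _).subset fun x hx => ⟨hx.1, hx.2 ⟨0, hs⟩⟩)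
    exact ⟨w, hw⟩
  · apply Metric.isCompact_of_isClosed_isBounded
    · have : SOLw K (fun i => evalFn (f i + g i)) =
          K ∩ ⋂ y ∈ K, ⋃ i, {x | evalFn (f i + g i) x ≤ evalFn (f i + g i) y} := by
        ext x
        simp [SOLw]
      rw [this]
      refine hKc.inter (isClosed_biInter fun y _ => isClosed_iUnion_of_finite fun i => ?_)
      exact isClosed_le (hcont i) continuous_const
    · refine (Bornology.isBounded_iUnion.2 fun i => hbd i (evalFn (f i + g i) a)).subset ?_
      intro x hx
      have := hx.2 a ha
      push Not at this
      obtain ⟨i, hi⟩ := this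
      exact Set.mem_iUnion.2 ⟨i, hx.1, hi⟩
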